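/- arXiv:0911.3305 — 2 statements merged into one kernel-verified Lean document; each statement's English description precedes it below -/
import Mathlib

section
/- The monoid G_Bvi⁺ admits neither the left-divisibility theory nor the right-divisibility theory; that is, it is NOT the case that every pair of elements of G_Bvi⁺ has a left least common multiple, and it is NOT the case that every pair of elements of G_Bvi⁺ has a right least common multiple. -/
/-- The three generators. -/
inductive Gen3 : Type
  | a | b | c

open FreeGroup in
/-- The defining relations of `G_Bvi`. -/
def theRels : Set (FreeGroup Gen3) :=
  { of .a * of .b * of .a * (of .b * of .a * of .b)⁻¹,
    of .a * of .c * of .a * (of .b * of .a * of .c)⁻¹,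
    of .a * of .c * of .a * of .c * of .a * (of .c * of .a * of .c * of .a * of .c)⁻¹ }

/-- The group `G_Bvi`. -/
abbrev G : Type := PresentedGroup theRels

/-- The monoid `G_Bvi⁺`: the submonoid of `G_Bvi` generated by the images of `a, b, c`. -/
abbrev Gplus : Submonoid G :=
  Submonoid.closure {PresentedGroup.of Gen3.a, PresentedGroup.of Gen3.b, PresentedGroup.of Gen3.c}

namespace GBvi

open PresentedGroup

/-- The images of the generators in `SL(2, 𝔽₅)`. -/
def toSLGen : Gen3 → Matrix.SpecialLinearGroup (Fin 2) (ZMod 5)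
  | .a => ⟨!![0, 4; 1, 2], by decide⟩
  | .b => ⟨!![0, 1; 4, 2], by decide⟩
  | .c => ⟨!![1, 0; 4, 1], by decide⟩

/-- A representation of `G_Bvi` on `𝔽₅²`. -/
def toSL : G →* Matrix.SpecialLinearGroup (Fin 2) (ZMod 5) :=
  toGroup (f := toSLGen) (by
    rintro r (rfl | rfl | rfl) <;> simp only [map_mul, map_inv, FreeGroup.lift_apply_of] <;>
      rw [mul_inv_eq_one] <;> decide)

/-- The homomorphism `G_Bvi → ℤ` sending every generator to `1`. -/
def degHom : G →* Multiplicative ℤ :=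
  toGroup (f := fun _ => Multiplicative.ofAdd 1) (by
    rintro r (rfl | rfl | rfl) <;> simp only [map_mul, map_inv, FreeGroup.lift_apply_of] <;>
      rw [mul_inv_eq_one])

/-- The degree of an element of `G_Bvi`. -/
def deg (g : G) : ℤ := (degHom g).toAdd

@[simp] lemma deg_mul (g h : G) : deg (g * h) = deg g + deg h := by simp [deg]

@[simp] lemma deg_one : deg 1 = 0 := by simp [deg]

@[simp] lemma deg_of (s : Gen3) : deg (of s) = 1 := by simp [deg, degHom]

@[simp] lemma toSL_of (s : Gen3) : toSL (of s) = toSLGen s := by simp [toSL]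

lemma braid_ab : (of .a * of .b * of .a : G) = of .b * of .a * of .b := by
  rw [← mul_inv_eq_one]
  exact one_of_mem (rels := theRels) (Or.inl rfl)

lemma aca_eq_bac : (of .a * of .c * of .a : G) = of .b * of .a * of .c := by
  rw [← mul_inv_eq_one]
  exact one_of_mem (rels := theRels) (Or.inr (Or.inl rfl))

lemma acaca_eq_cacac :
    (of .a * of .c * of .a * of .c * of .a : G) = of .c * of .a * of .c * of .a * of .c := by
  rw [← mul_inv_eq_one]
  exact one_of_mem (rels := theRels) (Or.inr (Or.inr rfl))

lemma acb_eq_cac : (of .a * of .c * of .b : G) = of .c * of .a * of .c := by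
  have h := acaca_eq_cacac
  rw [show (of .a * of .c * of .a * of .c * of .a : G)
    = of .a * of .c * (of .a * of .c * of .a) by group, aca_eq_bac] at h
  refine mul_right_cancel (b := of .a * of .c) ?_
  simpa only [mul_assoc] using h

/-- Conjugation by `ac` takes the braid relation of `a, b` to that of `b, c`. -/
lemma braid_bc : (of .b * of .c * of .b : G) = of .c * of .b * of .c := by
  have hb : (of .b : G) = of .a * of .c * of .a * (of .a * of .c)⁻¹ := by
    rw [aca_eq_bac]; group
  have hc : (of .c : G) = of .a * of .c * of .b * (of .a * of .c)⁻¹ := by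
    rw [acb_eq_cac]; group
  generalize (of .a * of .c : G) = t at hb hc
  have h := congrArg (fun g => t * g * t⁻¹) braid_ab
  calc (of .b * of .c * of .b : G)
      = t * of .a * t⁻¹ * (t * of .b * t⁻¹) * (t * of .a * t⁻¹) := by rw [← hb, ← hc]
    _ = t * (of .a * of .b * of .a) * t⁻¹ := by group
    _ = t * (of .b * of .a * of .b) * t⁻¹ := h
    _ = t * of .b * t⁻¹ * (t * of .a * t⁻¹) * (t * of .b * t⁻¹) := by group
    _ = of .c * of .b * of .c := by rw [← hb, ← hc]

lemma of_mem (s : Gen3) : of s ∈ Gplus := by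
  apply Submonoid.subset_closure
  cases s <;> simp

lemma small_degree {g : G} (hg : g ∈ Gplus) :
    g = 1 ∨ (∃ s, g = of s) ∨ 2 ≤ deg g := by
  have pos : ∀ {h : G}, ((∃ s, h = of s) ∨ 2 ≤ deg h) → 1 ≤ deg h := by
    rintro h (⟨s, rfl⟩ | h)
    · simp
    · omega
  induction hg using Submonoid.closure_induction with
  | mem x hx => rcases hx with rfl | rfl | rfl <;> exact Or.inr (Or.inl ⟨_, rfl⟩)
  | one => exact Or.inl rfl
  | mul x y _ _ hx hy =>
    rcases hx with rfl | hx
    · simpa using hy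
    rcases hy with rfl | hy
    · simpa using Or.inr hx
    have := pos hx
    have := pos hy
    exact Or.inr (Or.inr (by rw [deg_mul]; omega))

lemma eq_one_or_one_le_deg {g : G} (hg : g ∈ Gplus) : g = 1 ∨ 1 ≤ deg g := by
  rcases small_degree hg with h | ⟨s, rfl⟩ | h
  · exact Or.inl h
  · simp
  · exact Or.inr (by omega)

lemma of_injective : Function.Injective (of : Gen3 → G) := by
  intro s t h
  have h := congrArg toSL h
  rw [toSL_of, toSL_of] at h
  cases s <;> cases t <;> first | rfl | exact absurd h (by decide)

lemma of_mul_of_injective {s t u v : Gen3} (h : (of s * of t : G) = of u * of v) :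
    s = u ∧ t = v := by
  have h := congrArg toSL h
  simp only [map_mul, toSL_of] at h
  cases s <;> cases t <;> cases u <;> cases v <;>
    first | exact ⟨rfl, rfl⟩ | exact absurd h (by decide)

lemma two_le_deg_of_left {s t : Gen3} (hst : s ≠ t) {w z : G} (hw : w ∈ Gplus) (hz : z ∈ Gplus)
    (h : of s * w = of t * z) : 2 ≤ deg w := by
  have hd : deg w = deg z := by simpa using congrArg deg h
  rcases small_degree hw with rfl | ⟨u, rfl⟩ | hw' <;>
    rcases small_degree hz with rfl | ⟨v, rfl⟩ | hz' <;> simp at hd ⊢ <;> try omega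
  · exact hst (of_injective (by simpa using h))
  · exact hst (of_mul_of_injective h).1

lemma two_le_deg_of_right {s t : Gen3} (hst : s ≠ t) {w z : G} (hw : w ∈ Gplus) (hz : z ∈ Gplus)
    (h : w * of s = z * of t) : 2 ≤ deg w := by
  have hd : deg w = deg z := by simpa using congrArg deg h
  rcases small_degree hw with rfl | ⟨u, rfl⟩ | hw' <;>
    rcases small_degree hz with rfl | ⟨v, rfl⟩ | hz' <;> simp at hd ⊢ <;> try omega
  · exact hst (of_injective (by simpa using h))
  · exact hst (of_mul_of_injective h).2

/-- A generator, as an element of `G_Bvi⁺`. -/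
def gen (s : Gen3) : Gplus := ⟨of s, of_mem s⟩

/-- Two common left-multiples of degree `3` of distinct generators that have a left least common
multiple agree. -/
lemma eq_of_left_lcm {s t : Gen3} (hst : s ≠ t) {m n k w z p q : Gplus}
    (hw : m = gen s * w) (hz : m = gen t * z) (hn : n = m * p) (hk : k = m * q)
    (dn : deg n = 3) (dk : deg k = 3) : n = k := by
  have h2 := two_le_deg_of_left hst w.2 z.2 (congrArg Subtype.val (hw.symm.trans hz))
  have dm : deg m = 1 + deg w := by simp [hw, gen]
  have hp : deg n = deg m + deg p := by simp [hn]
  have hq : deg k = deg m + deg q := by simp [hk]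
  have p1 : p = 1 := Subtype.ext ((eq_one_or_one_le_deg p.2).resolve_right (by omega))
  have q1 : q = 1 := Subtype.ext ((eq_one_or_one_le_deg q.2).resolve_right (by omega))
  rw [hn, hk, p1, q1]

/-- Two common right-multiples of degree `3` of distinct generators that have a right least common
multiple agree. -/
lemma eq_of_right_lcm {s t : Gen3} (hst : s ≠ t) {m n k w z p q : Gplus}
    (hw : m = w * gen s) (hz : m = z * gen t) (hn : n = p * m) (hk : k = q * m)
    (dn : deg n = 3) (dk : deg k = 3) : n = k := by
  have h2 := two_le_deg_of_right hst w.2 z.2 (congrArg Subtype.val (hw.symm.trans hz))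
  have dm : deg m = deg w + 1 := by simp [hw, gen]
  have hp : deg n = deg p + deg m := by simp [hn]
  have hq : deg k = deg q + deg m := by simp [hk]
  have p1 : p = 1 := Subtype.ext ((eq_one_or_one_le_deg p.2).resolve_right (by omega))
  have q1 : q = 1 := Subtype.ext ((eq_one_or_one_le_deg q.2).resolve_right (by omega))
  rw [hn, hk, p1, q1]

end GBvi

open GBvi in
/-- `G_Bvi⁺` admits neither the left- nor the right-divisibility theory: it is not
the case that any two elements have a left least common multiple, nor that any two
elements have a right least common multiple. -/
theorem Gplus_no_divisibility_theory :
    (¬ ∀ x y : Gplus, ∃ m : Gplus,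
        (∃ w : Gplus, m = x * w) ∧ (∃ w : Gplus, m = y * w) ∧
        ∀ n : Gplus, (∃ w : Gplus, n = x * w) → (∃ w : Gplus, n = y * w) →
          ∃ w : Gplus, n = m * w) ∧
    (¬ ∀ x y : Gplus, ∃ m : Gplus,
        (∃ w : Gplus, m = w * x) ∧ (∃ w : Gplus, m = w * y) ∧
        ∀ n : Gplus, (∃ w : Gplus, n = w * x) → (∃ w : Gplus, n = w * y) →
          ∃ w : Gplus, n = w * m) := by
  constructor
  · intro H
    obtain ⟨m, ⟨w, hw⟩, ⟨z, hz⟩, hm⟩ := H (gen .a) (gen .b)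
    obtain ⟨p, hp⟩ := hm (gen .a * gen .b * gen .a) ⟨gen .b * gen .a, mul_assoc _ _ _⟩
      ⟨gen .a * gen .b, (Subtype.ext braid_ab).trans (mul_assoc _ _ _)⟩
    obtain ⟨q, hq⟩ := hm (gen .a * gen .c * gen .a) ⟨gen .c * gen .a, mul_assoc _ _ _⟩
      ⟨gen .a * gen .c, (Subtype.ext aca_eq_bac).trans (mul_assoc _ _ _)⟩
    have h := congrArg Subtype.val
      (eq_of_left_lcm (s := .a) (t := .b) nofun hw hz hp hq (by simp [gen]) (by simp [gen]))
    have := of_injective (mul_left_cancel (mul_right_cancel h))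
    contradiction
  · intro H
    obtain ⟨m, ⟨w, hw⟩, ⟨z, hz⟩, hm⟩ := H (gen .b) (gen .c)
    obtain ⟨p, hp⟩ := hm (gen .a * gen .c * gen .b) ⟨gen .a * gen .c, rfl⟩
      ⟨gen .c * gen .a, Subtype.ext acb_eq_cac⟩
    obtain ⟨q, hq⟩ := hm (gen .b * gen .c * gen .b) ⟨gen .b * gen .c, rfl⟩
      ⟨gen .c * gen .b, Subtype.ext braid_bc⟩
    have h := congrArg Subtype.val
      (eq_of_right_lcm (s := .b) (t := .c) nofun hw hz hp hq (by simp [gen]) (by simp [gen]))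
    have := of_injective (mul_right_cancel (mul_right_cancel h))
    contradiction
end

section
/- There is a group isomorphism from G_Bvi to G_Hiii sending a ↦ b, b ↦ a, and c ↦ c. -/
open FreeGroup in
/-- The relations `aba = bab`, `aca = bac`, `acaca = cacac` of `G_Bvi`. -/
def bviRels : Set (FreeGroup Gen3) :=
  { of .a * of .b * of .a * (of .b * of .a * of .b)⁻¹,
    of .a * of .c * of .a * (of .b * of .a * of .c)⁻¹,
    of .a * of .c * of .a * of .c * of .a * (of .c * of .a * of .c * of .a * of .c)⁻¹ }

open FreeGroup in
/-- The relations `aba = bab`, `bcba = cbac`, `cba = acb` of `G_Hiii`. -/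
def hiiiRels : Set (FreeGroup Gen3) :=
  { of .a * of .b * of .a * (of .b * of .a * of .b)⁻¹,
    of .b * of .c * of .b * of .a * (of .c * of .b * of .a * of .c)⁻¹,
    of .c * of .b * of .a * (of .a * of .c * of .b)⁻¹ }

section Words

variable {G : Type*} [Group G] {a b c : G}

/-- In a group satisfying the relations of `G_Bvi`, `acb = cac`. -/
theorem acb_eq_cac_of_bvi (aca : a * c * a = b * a * c)
    (acaca : a * c * a * c * a = c * a * c * a * c) : a * c * b = c * a * c := by
  refine mul_right_cancel (b := a * c) ?_
  calc a * c * b * (a * c) = a * c * (b * a * c) := by simp only [mul_assoc]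
    _ = a * c * a * c * a := by rw [← aca]; simp only [mul_assoc]
    _ = c * a * c * (a * c) := by rw [acaca]; simp only [mul_assoc]

/-- In a group satisfying the relations of `G_Bvi`, `bcb = cbc`. -/
theorem bcb_eq_cbc_of_bvi (aba : a * b * a = b * a * b) (aca : a * c * a = b * a * c)
    (acb : a * c * b = c * a * c) : b * c * b = c * b * c := by
  refine mul_right_cancel (b := a * c) ?_
  calc b * c * b * (a * c) = b * c * (b * a * c) := by simp only [mul_assoc]
    _ = b * (c * a * c) * a := by rw [← aca]; simp only [mul_assoc]
    _ = b * a * c * b * a := by rw [← acb]; simp only [mul_assoc]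
    _ = a * c * (a * b * a) := by rw [← aca]; simp only [mul_assoc]
    _ = a * c * b * a * b := by rw [aba]; simp only [mul_assoc]
    _ = c * (a * c * a) * b := by rw [acb]; simp only [mul_assoc]
    _ = c * b * (a * c * b) := by rw [aca]; simp only [mul_assoc]
    _ = c * b * c * (a * c) := by rw [acb]; simp only [mul_assoc]

/-- In a group satisfying the relations of `G_Bvi`, `abacb = acabc`. -/
theorem abacb_eq_acabc_of_bvi (aba : a * b * a = b * a * b) (aca : a * c * a = b * a * c)
    (bcb : b * c * b = c * b * c) : a * b * a * c * b = a * c * a * b * c := by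
  calc a * b * a * c * b = b * a * (b * c * b) := by rw [aba]; simp only [mul_assoc]
    _ = b * a * c * b * c := by rw [bcb]; simp only [mul_assoc]
    _ = a * c * a * b * c := by rw [← aca]

/-- In a group satisfying the relations of `G_Bvi`, `cab = bca`. -/
theorem cab_eq_bca_of_bvi (acb : a * c * b = c * a * c)
    (abacb : a * b * a * c * b = a * c * a * b * c) : c * a * b = b * c * a := by
  refine mul_left_cancel (a := a) (mul_right_cancel (b := c) ?_)
  calc a * (c * a * b) * c = a * c * a * b * c := by simp only [mul_assoc]
    _ = a * b * (a * c * b) := by rw [← abacb]; simp only [mul_assoc]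
    _ = a * (b * c * a) * c := by rw [acb]; simp only [mul_assoc]

/-- In a group satisfying the relations of `G_Bvi`, `acab = cabc`. -/
theorem acab_eq_cabc_of_bvi (aca : a * c * a = b * a * c)
    (abacb : a * b * a * c * b = a * c * a * b * c) : a * c * a * b = c * a * b * c := by
  refine mul_left_cancel (a := a) ?_
  calc a * (a * c * a * b) = a * (a * c * a) * b := by simp only [mul_assoc]
    _ = a * b * a * c * b := by rw [aca]; simp only [mul_assoc]
    _ = a * (c * a * b * c) := by rw [abacb]; simp only [mul_assoc]

/-- In a group satisfying the relations of `G_Hiii` with `a` and `b` exchanged, `acb = cac`. -/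
theorem acb_eq_cac_of_hiii (aba : a * b * a = b * a * b)
    (acab : a * c * a * b = c * a * b * c) (cab : c * a * b = b * c * a) :
    a * c * b = c * a * c := by
  refine mul_right_cancel (b := a * b) ?_
  calc a * c * b * (a * b) = a * c * (b * a * b) := by simp only [mul_assoc]
    _ = a * c * a * b * a := by rw [← aba]; simp only [mul_assoc]
    _ = c * a * (b * c * a) := by rw [acab]; simp only [mul_assoc]
    _ = c * a * c * (a * b) := by rw [← cab]; simp only [mul_assoc]

/-- In a group satisfying the relations of `G_Hiii` with `a` and `b` exchanged, `aca = bac`. -/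
theorem aca_eq_bac_of_hiii (acab : a * c * a * b = c * a * b * c)
    (cab : c * a * b = b * c * a) (acb : a * c * b = c * a * c) : a * c * a = b * a * c := by
  refine mul_right_cancel (b := b) ?_
  calc a * c * a * b = b * (c * a * c) := by rw [acab, cab]; simp only [mul_assoc]
    _ = b * a * c * b := by rw [← acb]; simp only [mul_assoc]

/-- In a group satisfying the relations of `G_Hiii` with `a` and `b` exchanged,
`acaca = cacac`. -/
theorem acaca_eq_cacac_of_hiii (aca : a * c * a = b * a * c) (acb : a * c * b = c * a * c) :
    a * c * a * c * a = c * a * c * a * c := by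
  calc a * c * a * c * a = a * c * (a * c * a) := by simp only [mul_assoc]
    _ = a * c * b * a * c := by rw [aca]; simp only [mul_assoc]
    _ = c * a * c * a * c := by rw [acb]

end Words

/-- The exchange of the generators `a` and `b`, fixing `c`. -/
def Gen3.swapAB : Gen3 → Gen3
  | .a => .b
  | .b => .a
  | .c => .c

namespace PresentedGroup

theorem bvi_relations_in_hiii :
    ∀ r ∈ bviRels, FreeGroup.lift (fun i => (of i.swapAB : PresentedGroup hiiiRels)) r = 1 := by
  have aba : (of .a * of .b * of .a : PresentedGroup hiiiRels) = of .b * of .a * of .b :=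
    mk_eq_mk_of_mul_inv_mem (Or.inl rfl)
  have bcba : (of .b * of .c * of .b * of .a : PresentedGroup hiiiRels)
      = of .c * of .b * of .a * of .c := mk_eq_mk_of_mul_inv_mem (Or.inr (Or.inl rfl))
  have cba : (of .c * of .b * of .a : PresentedGroup hiiiRels) = of .a * of .c * of .b :=
    mk_eq_mk_of_mul_inv_mem (Or.inr (Or.inr rfl))
  have bca := acb_eq_cac_of_hiii aba.symm bcba cba
  have bcb := aca_eq_bac_of_hiii bcba cba bca
  rintro r (rfl | rfl | rfl) <;>
    simp only [map_mul, map_inv, FreeGroup.lift_apply_of, mul_inv_eq_one, Gen3.swapAB]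
  · exact aba.symm
  · exact bcb
  · exact acaca_eq_cacac_of_hiii bcb bca

theorem hiii_relations_in_bvi :
    ∀ r ∈ hiiiRels, FreeGroup.lift (fun i => (of i.swapAB : PresentedGroup bviRels)) r = 1 := by
  have aba : (of .a * of .b * of .a : PresentedGroup bviRels) = of .b * of .a * of .b :=
    mk_eq_mk_of_mul_inv_mem (Or.inl rfl)
  have aca : (of .a * of .c * of .a : PresentedGroup bviRels) = of .b * of .a * of .c :=
    mk_eq_mk_of_mul_inv_mem (Or.inr (Or.inl rfl))
  have acaca : (of .a * of .c * of .a * of .c * of .a : PresentedGroup bviRels)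
      = of .c * of .a * of .c * of .a * of .c := mk_eq_mk_of_mul_inv_mem (Or.inr (Or.inr rfl))
  have acb := acb_eq_cac_of_bvi aca acaca
  have abacb := abacb_eq_acabc_of_bvi aba aca (bcb_eq_cbc_of_bvi aba aca acb)
  rintro r (rfl | rfl | rfl) <;>
    simp only [map_mul, map_inv, FreeGroup.lift_apply_of, mul_inv_eq_one, Gen3.swapAB]
  · exact aba.symm
  · exact acab_eq_cabc_of_bvi aca abacb
  · exact cab_eq_bca_of_bvi acb abacb

end PresentedGroup

/-- There is a group isomorphism `G_Bvi ≃ G_Hiii` with `a ↦ b`, `b ↦ a`, `c ↦ c`. -/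
theorem GBvi_iso_GHiii :
    ∃ e : PresentedGroup bviRels ≃* PresentedGroup hiiiRels,
      e (PresentedGroup.of Gen3.a) = PresentedGroup.of Gen3.b ∧
      e (PresentedGroup.of Gen3.b) = PresentedGroup.of Gen3.a ∧
      e (PresentedGroup.of Gen3.c) = PresentedGroup.of Gen3.c := by
  refine ⟨MonoidHom.toMulEquiv
    (PresentedGroup.toGroup PresentedGroup.bvi_relations_in_hiii)
    (PresentedGroup.toGroup PresentedGroup.hiii_relations_in_bvi) ?_ ?_, ?_, ?_, ?_⟩
  · ext i
    cases i <;> simp [Gen3.swapAB]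
  · ext i
    cases i <;> simp [Gen3.swapAB]
  all_goals simp [Gen3.swapAB]
end
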